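/- arXiv:2308.03648 — 4 statements merged into one kernel-verified Lean document; each statement's English description precedes it below -/
import Mathlib

section
/- Let ℓ₁, ℓ₋₁ : [0,1] → ℝ be the partial losses of a strictly proper CPE loss, with conditional risk R(p,u) := p·ℓ₁(u) + (1−p)·ℓ₋₁(u) and pointwise Bayes risk L(p) := inf_{u ∈ [0,1]} R(p,u). Then L is strictly concave on [0,1]: for all p, q ∈ [0,1] with p ≠ q and all λ ∈ (0,1), L(λ·p + (1−λ)·q) > λ·L(p) + (1−λ)·L(q). -/
/-- the pointwise Bayes risk of a strictly proper CPE loss is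
strictly concave on `[0,1]`. -/
theorem bayes_risk_strictConcave
    (ℓ1 ℓm1 : ℝ → ℝ)
    (R : ℝ → ℝ → ℝ)
    (hRdef : ∀ p u, R p u = p * ℓ1 u + (1 - p) * ℓm1 u)
    (L : ℝ → ℝ)
    (hLdef : ∀ p, L p = sInf ((fun u => R p u) '' Set.Icc (0:ℝ) 1))
    (hproper : ∀ p ∈ Set.Icc (0:ℝ) 1, L p = R p p)
    (hstrict : ∀ p ∈ Set.Icc (0:ℝ) 1, ∀ u ∈ Set.Icc (0:ℝ) 1, u ≠ p → L p < R p u) :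
    ∀ p ∈ Set.Icc (0:ℝ) 1, ∀ q ∈ Set.Icc (0:ℝ) 1, p ≠ q →
      ∀ l : ℝ, 0 < l → l < 1 →
        l * L p + (1 - l) * L q < L (l * p + (1 - l) * q) := by
  intro p hp q hq hpq l hl0 hl1
  set m := l * p + (1 - l) * q with hm
  have hl1' : 0 < 1 - l := sub_pos.mpr hl1
  have hmem : m ∈ Set.Icc (0:ℝ) 1 := by
    simpa [hm] using convex_Icc (0:ℝ) 1 hp hq hl0.le hl1'.le (by ring)
  have hmp : m ≠ p := fun h =>
    mul_ne_zero hl1'.ne' (sub_ne_zero.mpr hpq) (by linear_combination hm - h)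
  have hmq : m ≠ q := fun h =>
    mul_ne_zero hl0.ne' (sub_ne_zero.mpr hpq) (by linear_combination h - hm)
  calc l * L p + (1 - l) * L q < l * R p m + (1 - l) * R q m :=
        add_lt_add (mul_lt_mul_of_pos_left (hstrict p hp m hmem hmp) hl0)
          (mul_lt_mul_of_pos_left (hstrict q hq m hmem hmq) hl1')
    _ = R m m := by
        simp only [hRdef]
        linear_combination (ℓm1 m - ℓ1 m) * hm
    _ = L m := (hproper m hmem).symm
end

section
/- Let (X, μ) be a probability space, f : X → ℝ integrable, and F : ℝ → ℝ convex and differentiable with F ∘ f integrable. Let P and P' be two finite measurable partitions of X whose cells all have positive measure, with conditional-mean simplifications h_P and h_{P'} of f. Then ∫ D_F(f‖h_P) dμ − ∫ D_F(f‖h_{P'}) dμ = Σ_{C'∈P'} μ(C')·F(c_{C'}) − Σ_{C∈P} μ(C)·F(c_C), where c_C denotes the μ-average of f on the cell C. That is, the decrease in the integrated Bregman divergence between two partition models equals the difference of the corresponding expected generator values of the cell averages. -/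
open MeasureTheory

/-- On a cell of a finite disjoint family, the sum of the cell indicators is the value of that
cell. -/
lemma sum_indicator_const_eq_of_mem {X I : Type*} [Fintype I] {C : I → Set X}
    (hdisj : Pairwise (Function.onFun Disjoint C)) (c : I → ℝ) {i : I} {x : X} (hx : x ∈ C i) :
    ∑ j, (C j).indicator (fun _ => c j) x = c i := by
  rw [Fintype.sum_eq_single i, Set.indicator_of_mem hx]
  intro j hj
  exact Set.indicator_of_notMem (fun hxj => Set.disjoint_left.mp (hdisj hj) hxj hx) _

/-- The integrated Bregman divergence of `f` from its conditional mean over a finite partition is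
the integral of `F ∘ f` minus the expected generator value of the cell averages. -/
lemma integral_bregman_partition {X : Type*} [MeasurableSpace X] (μ : Measure X)
    [IsFiniteMeasure μ] {f : X → ℝ} (hf : Integrable f μ) (F F' : ℝ → ℝ)
    (hFf : Integrable (F ∘ f) μ) {I : Type*} [Fintype I] {C : I → Set X}
    (hmeas : ∀ i, MeasurableSet (C i)) (hpos : ∀ i, 0 < μ (C i))
    (hdisj : Pairwise (Function.onFun Disjoint C)) (hcover : (⋃ i, C i) = Set.univ)
    {c : I → ℝ} (hc : ∀ i, c i = (∫ x in C i, f x ∂μ) / (μ (C i)).toReal)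
    {h : X → ℝ} (hh : ∀ x, h x = ∑ i, Set.indicator (C i) (fun _ => c i) x) :
    ∫ x, (F (f x) - F (h x) - (f x - h x) * F' (h x)) ∂μ
      = (∫ x, F (f x) ∂μ) - ∑ i, (μ (C i)).toReal * F (c i) := by
  have hFf' : Integrable (fun x => F (f x)) μ := hFf
  have hcongr (i : I) : Set.EqOn (fun x => F (f x) - F (c i) - (f x - c i) * F' (c i))
      (fun x => F (f x) - F (h x) - (f x - h x) * F' (h x)) (C i) := by
    intro x hx
    have hx' : h x = c i := (hh x).trans (sum_indicator_const_eq_of_mem hdisj c hx)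
    simp only [hx']
  have hgen (i : I) : Integrable (fun x => F (f x) - F (c i)) μ := hFf'.sub (integrable_const _)
  have hlin (i : I) : Integrable (fun x => (f x - c i) * F' (c i)) μ :=
    (hf.sub (integrable_const _)).mul_const _
  have hcell (i : I) :
      ∫ x in C i, (F (f x) - F (h x) - (f x - h x) * F' (h x)) ∂μ
        = (∫ x in C i, F (f x) ∂μ) - (μ (C i)).toReal * F (c i) := by
    have hμ : (μ (C i)).toReal ≠ 0 :=
      (ENNReal.toReal_pos (hpos i).ne' (measure_ne_top μ _)).ne'
    have hmean : ∫ x in C i, f x ∂μ = (μ (C i)).toReal * c i := by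
      rw [hc i, mul_div_cancel₀ _ hμ]
    rw [← setIntegral_congr_fun (hmeas i) (hcongr i),
      integral_sub (hgen i).restrict (hlin i).restrict,
      integral_sub hFf'.restrict (integrable_const _), integral_mul_const,
      integral_sub hf.restrict (integrable_const _), hmean]
    simp [Measure.real]
  rw [← setIntegral_univ, ← setIntegral_univ (f := fun x => F (f x)), ← hcover,
    integral_iUnion_fintype hmeas hdisj
      fun i => ((hgen i).sub (hlin i)).integrableOn.congr_fun (hcongr i) (hmeas i),
    integral_iUnion_fintype hmeas hdisj fun i => hFf'.integrableOn,
    ← Finset.sum_sub_distrib]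
  exact Finset.sum_congr rfl fun i _ => hcell i

/-- the decrease of the integrated Bregman divergence between two
partition models equals the difference of the corresponding expected generator
values of the cell averages. -/
theorem integral_bregman_diff_partitions
    {X : Type*} [MeasurableSpace X] (μ : Measure X) [IsProbabilityMeasure μ]
    (f : X → ℝ) (hf : Integrable f μ)
    (F F' : ℝ → ℝ) (hF : ConvexOn ℝ Set.univ F)
    (hF' : ∀ x, HasDerivAt F (F' x) x)
    (hFf : Integrable (F ∘ f) μ)
    -- partition P
    {I : Type*} [Fintype I] (C : I → Set X)
    (hmeas : ∀ i, MeasurableSet (C i))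
    (hpos : ∀ i, 0 < μ (C i))
    (hdisj : Pairwise (Function.onFun Disjoint C))
    (hcover : (⋃ i, C i) = Set.univ)
    (c : I → ℝ) (hc : ∀ i, c i = (∫ x in C i, f x ∂μ) / (μ (C i)).toReal)
    (h : X → ℝ) (hh : ∀ x, h x = ∑ i, Set.indicator (C i) (fun _ => c i) x)
    -- partition P'
    {I' : Type*} [Fintype I'] (C' : I' → Set X)
    (hmeas' : ∀ i, MeasurableSet (C' i))
    (hpos' : ∀ i, 0 < μ (C' i))
    (hdisj' : Pairwise (Function.onFun Disjoint C'))
    (hcover' : (⋃ i, C' i) = Set.univ)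
    (c' : I' → ℝ) (hc' : ∀ i, c' i = (∫ x in C' i, f x ∂μ) / (μ (C' i)).toReal)
    (h' : X → ℝ) (hh' : ∀ x, h' x = ∑ i, Set.indicator (C' i) (fun _ => c' i) x) :
    (∫ x, (F (f x) - F (h x) - (f x - h x) * F' (h x)) ∂μ)
      - (∫ x, (F (f x) - F (h' x) - (f x - h' x) * F' (h' x)) ∂μ)
      = (∑ i, (μ (C' i)).toReal * F (c' i)) - ∑ i, (μ (C i)).toReal * F (c i) := by
  rw [integral_bregman_partition μ hf F F' hFf hmeas hpos hdisj hcover hc hh,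
    integral_bregman_partition μ hf F F' hFf hmeas' hpos' hdisj' hcover' hc' hh']
  ring
end

section
/- Let L : [0,1] → ℝ be differentiable and strictly concave, π ∈ (0,1) and p ∈ (0,1). For q ∈ [0,1] set τ(q) := π·p + (1−π)·q and μ(q) := τ(q)·L(π·p/τ(q)) + (1−τ(q))·L(π·(1−p)/(1−τ(q))). Then μ is strictly increasing on [0,p] and strictly decreasing on [p,1]; in particular q = p is the unique maximizer of μ on [0,1]. -/
/-- The perspective `t ↦ t * L (c / t)` of a concave function on `[0,1]` is concave on `[c, ∞)`. -/
lemma ConcaveOn.perspective {L : ℝ → ℝ} (hL : ConcaveOn ℝ (Set.Icc (0:ℝ) 1) L)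
    {c : ℝ} (hc : 0 < c) : ConcaveOn ℝ (Set.Ici c) fun t => t * L (c / t) := by
  refine ⟨convex_Ici c, fun x hx y hy a b ha hb hab => ?_⟩
  have hxc : c ≤ x := hx
  have hyc : c ≤ y := hy
  have ht : c ≤ a * x + b * y := convex_Ici c hx hy ha hb hab
  have hx0 : 0 < x := hc.trans_le hxc
  have hy0 : 0 < y := hc.trans_le hyc
  have ht0 : 0 < a * x + b * y := hc.trans_le ht
  have hmem : ∀ {z : ℝ}, c ≤ z → c / z ∈ Set.Icc (0:ℝ) 1 := fun {z} hz =>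
    ⟨(div_pos hc (hc.trans_le hz)).le, (div_le_one (hc.trans_le hz)).2 hz⟩
  have key := hL.2 (hmem hxc) (hmem hyc)
    (show 0 ≤ a * x / (a * x + b * y) by positivity)
    (show 0 ≤ b * y / (a * x + b * y) by positivity) (by rw [← add_div, div_self ht0.ne'])
  have harg : a * x / (a * x + b * y) * (c / x) + b * y / (a * x + b * y) * (c / y)
      = c / (a * x + b * y) := by
    have : a * x / (a * x + b * y) * (c / x) + b * y / (a * x + b * y) * (c / y)
        = (a + b) * c / (a * x + b * y) := by field_simp
    rw [this, hab, one_mul]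
  simp only [smul_eq_mul] at key ⊢
  rw [harg] at key
  calc a * (x * L (c / x)) + b * (y * L (c / y))
      = (a * x + b * y) * (a * x / (a * x + b * y) * L (c / x)
          + b * y / (a * x + b * y) * L (c / y)) := by field_simp
    _ ≤ _ := mul_le_mul_of_nonneg_left key ht0.le

/-- A concave function with a strict maximum at `p` increases strictly towards `p`. -/
lemma ConcaveOn.lt_of_mem_openSegment {s : Set ℝ} {f : ℝ → ℝ} (hf : ConcaveOn ℝ s f)
    {x y p : ℝ} (hx : x ∈ s) (hp : p ∈ s) (hlt : f x < f p) (hy : y ∈ openSegment ℝ x p) :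
    f x < f y := by
  obtain ⟨a, b, ha, hb, hab, rfl⟩ := hy
  have h := hf.2 hx hp ha.le hb.le hab
  have hax : a * f x + b * f x = f x := by rw [← add_mul, hab, one_mul]
  have := mul_lt_mul_of_pos_left hlt hb
  simp only [smul_eq_mul] at h ⊢
  linarith

/-- the expected pointwise Bayes risk contribution of a split, as
a function of the conditional uniform mass `q`, is strictly increasing on
`[0,p]`, strictly decreasing on `[p,1]`, and uniquely maximized at `q = p`. -/
theorem split_criterion_unimodal
    (L L' : ℝ → ℝ)
    (hL : ∀ x ∈ Set.Icc (0:ℝ) 1, HasDerivWithinAt L (L' x) (Set.Icc (0:ℝ) 1) x)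
    (hconc : StrictConcaveOn ℝ (Set.Icc (0:ℝ) 1) L)
    (π p : ℝ) (hπ : π ∈ Set.Ioo (0:ℝ) 1) (hp : p ∈ Set.Ioo (0:ℝ) 1)
    (μ : ℝ → ℝ)
    (hμ : ∀ q, μ q = (π * p + (1 - π) * q) * L (π * p / (π * p + (1 - π) * q))
        + (1 - (π * p + (1 - π) * q))
          * L (π * (1 - p) / (1 - (π * p + (1 - π) * q)))) :
    StrictMonoOn μ (Set.Icc (0:ℝ) p) ∧ StrictAntiOn μ (Set.Icc p 1) ∧
      ∀ q ∈ Set.Icc (0:ℝ) 1, q ≠ p → μ q < μ p := by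
  obtain ⟨hπ0, hπ1⟩ := hπ
  obtain ⟨hp0, hp1⟩ := hp
  have hc : 0 < π * p := mul_pos hπ0 hp0
  have hd : 0 < π * (1 - p) := mul_pos hπ0 (by linarith)
  have hτ : ∀ q ∈ Set.Icc (0:ℝ) 1, π * p ≤ π * p + (1 - π) * q := fun q hq => by
    nlinarith [mul_nonneg (sub_nonneg.2 hπ1.le) hq.1]
  have hτ' : ∀ q ∈ Set.Icc (0:ℝ) 1, π * (1 - p) ≤ 1 - (π * p + (1 - π) * q) := fun q hq => by
    nlinarith [mul_nonneg (sub_nonneg.2 hπ1.le) (sub_nonneg.2 hq.2)]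
  have hpI : p ∈ Set.Icc (0:ℝ) 1 := ⟨hp0.le, hp1.le⟩
  have hμconc : ConcaveOn ℝ (Set.Icc (0:ℝ) 1) μ := by
    refine ⟨convex_Icc 0 1, fun x hx y hy a b ha hb hab => ?_⟩
    have h₁ := (hconc.concaveOn.perspective hc).2 (hτ x hx) (hτ y hy) ha hb hab
    have h₂ := (hconc.concaveOn.perspective hd).2 (hτ' x hx) (hτ' y hy) ha hb hab
    obtain rfl : b = 1 - a := by linarith
    simp only [smul_eq_mul] at h₁ h₂ ⊢
    have e₁ : a * (π * p + (1 - π) * x) + (1 - a) * (π * p + (1 - π) * y)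
        = π * p + (1 - π) * (a * x + (1 - a) * y) := by ring
    have e₂ : a * (1 - (π * p + (1 - π) * x)) + (1 - a) * (1 - (π * p + (1 - π) * y))
        = 1 - (π * p + (1 - π) * (a * x + (1 - a) * y)) := by ring
    rw [e₁] at h₁
    rw [e₂] at h₂
    rw [hμ, hμ, hμ]
    linarith
  have hμp : μ p = L π := by
    have hp1' : 1 - p ≠ 0 := by linarith
    rw [hμ, show π * p + (1 - π) * p = p by ring, mul_div_cancel_right₀ _ hp0.ne',
      mul_div_cancel_right₀ _ hp1']
    ring
  have hmax : ∀ q ∈ Set.Icc (0:ℝ) 1, q ≠ p → μ q < μ p := by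
    intro q hq hqp
    have h₁ := hτ q hq
    have h₂ := hτ' q hq
    have hne : (1 - π) * q ≠ (1 - π) * p := fun h =>
      hqp (mul_left_cancel₀ (sub_pos.2 hπ1).ne' h)
    rw [hμp, hμ]
    set t := π * p + (1 - π) * q with ht
    have ht0 : 0 < t := hc.trans_le h₁
    have ht1 : 0 < 1 - t := hd.trans_le h₂
    have key := hconc.2 (x := π * p / t) (y := π * (1 - p) / (1 - t))
      ⟨by positivity, (div_le_one ht0).2 h₁⟩ ⟨by positivity, (div_le_one ht1).2 h₂⟩
      (by
        intro h
        rw [div_eq_div_iff ht0.ne' ht1.ne'] at h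
        have : π * (p - t) = 0 := by linarith
        rcases mul_eq_zero.1 this with h | h
        · exact hπ0.ne' h
        · exact hne (by linarith))
      ht0 ht1 (by ring)
    simp only [smul_eq_mul] at key
    rwa [mul_div_cancel₀ _ ht0.ne', mul_div_cancel₀ _ ht1.ne',
      show π * p + π * (1 - p) = π by ring] at key
  refine ⟨fun x hx y hy hxy => ?_, fun x hx y hy hxy => ?_, hmax⟩
  · have hxI : x ∈ Set.Icc (0:ℝ) 1 := ⟨hx.1, hx.2.trans hp1.le⟩
    have hxp := hmax x hxI (hxy.trans_le hy.2).ne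
    rcases hy.2.eq_or_lt with rfl | hyp
    · exact hxp
    · refine hμconc.lt_of_mem_openSegment hxI hpI hxp ?_
      rw [openSegment_eq_Ioo (hxy.trans hyp)]
      exact ⟨hxy, hyp⟩
  · have hyI : y ∈ Set.Icc (0:ℝ) 1 := ⟨hp0.le.trans hy.1, hy.2⟩
    have hyp := hmax y hyI (hx.1.trans_lt hxy).ne'
    rcases hx.1.eq_or_lt with rfl | hpx
    · exact hyp
    · refine hμconc.lt_of_mem_openSegment hyI hpI hyp ?_
      rw [openSegment_symm, openSegment_eq_Ioo (hpx.trans hxy)]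
      exact ⟨hpx, hxy⟩
end

section
/- Let L : [0,1] → ℝ be differentiable and strictly concave, π ∈ (0,1) and p ∈ (0,1), and define μ(q) := τ(q)·L(π·p/τ(q)) + (1−τ(q))·L(π·(1−p)/(1−τ(q))) with τ(q) := π·p + (1−π)·q for q ∈ [0,1]. Then for any 0 ≤ q₀ ≤ q₁ ≤ 1 and any q ∈ [q₀, q₁], μ(q) ≥ min(μ(q₀), μ(q₁)): the minimum of μ over the interval [q₀, q₁] is attained at one of its endpoints. -/
/-- The perspective `t ↦ t * L (a / t)` of a function concave on `[0, 1]` is concave on `[a, ∞)`. -/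
theorem ConcaveOn.perspective_Ici {L : ℝ → ℝ} (hL : ConcaveOn ℝ (Set.Icc (0 : ℝ) 1) L)
    {a : ℝ} (ha : 0 < a) : ConcaveOn ℝ (Set.Ici a) (fun t => t * L (a / t)) := by
  refine ⟨convex_Ici a, fun x hx y hy α β hα hβ hαβ => ?_⟩
  have hT : a ≤ α • x + β • y := convex_Ici a hx hy hα hβ hαβ
  simp only [Set.mem_Ici, smul_eq_mul] at hx hy hT ⊢
  have hx0 : 0 < x := ha.trans_le hx
  have hy0 : 0 < y := ha.trans_le hy
  set T := α * x + β * y with hTdef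
  have hT0 : 0 < T := ha.trans_le hT
  have mem_unit : ∀ z, a ≤ z → a / z ∈ Set.Icc (0 : ℝ) 1 := fun z hz =>
    ⟨div_nonneg ha.le (ha.le.trans hz), div_le_one_of_le₀ hz (ha.le.trans hz)⟩
  have key := hL.2 (mem_unit x hx) (mem_unit y hy)
    (show 0 ≤ α * x / T by positivity) (show 0 ≤ β * y / T by positivity)
    (by rw [← add_div, ← hTdef, div_self hT0.ne'])
  have hpt : α * x / T * (a / x) + β * y / T * (a / y) = a / T := by
    field_simp
    linear_combination hαβ
  simp only [smul_eq_mul, hpt] at key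
  calc α * (x * L (a / x)) + β * (y * L (a / y))
      = T * (α * x / T * L (a / x) + β * y / T * L (a / y)) := by field_simp
    _ ≤ T * L (a / T) := mul_le_mul_of_nonneg_left key hT0.le

/-- over any subinterval `[q₀, q₁] ⊆ [0,1]`, the expected
pointwise Bayes risk contribution of a split attains its minimum at one of the
endpoints (so the optimal threshold for a single tree lies at an observed
value). -/
theorem split_criterion_min_at_endpoints
    (L L' : ℝ → ℝ)
    (hL : ∀ x ∈ Set.Icc (0:ℝ) 1, HasDerivWithinAt L (L' x) (Set.Icc (0:ℝ) 1) x)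
    (hconc : StrictConcaveOn ℝ (Set.Icc (0:ℝ) 1) L)
    (π p : ℝ) (hπ : π ∈ Set.Ioo (0:ℝ) 1) (hp : p ∈ Set.Ioo (0:ℝ) 1)
    (μ : ℝ → ℝ)
    (hμ : ∀ q, μ q = (π * p + (1 - π) * q) * L (π * p / (π * p + (1 - π) * q))
        + (1 - (π * p + (1 - π) * q))
          * L (π * (1 - p) / (1 - (π * p + (1 - π) * q)))) :
    ∀ q₀ q₁ : ℝ, 0 ≤ q₀ → q₀ ≤ q₁ → q₁ ≤ 1 →
      ∀ q ∈ Set.Icc q₀ q₁, min (μ q₀) (μ q₁) ≤ μ q := by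
  intro q₀ q₁ h₀ h₀₁ h₁ q hq
  obtain ⟨hπ0, hπ1⟩ := hπ
  obtain ⟨hp0, hp1⟩ := hp
  have true_branch := hconc.concaveOn.perspective_Ici (mul_pos hπ0 hp0)
  have false_branch := hconc.concaveOn.perspective_Ici (mul_pos hπ0 (sub_pos.2 hp1))
  have hμ_concave : ConcaveOn ℝ (Set.Icc (0 : ℝ) 1) μ := by
    refine ⟨convex_Icc 0 1, fun x hx y hy α β hα hβ hαβ => ?_⟩
    have mem_true : ∀ z ∈ Set.Icc (0 : ℝ) 1, π * p + (1 - π) * z ∈ Set.Ici (π * p) :=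
      fun z hz => Set.mem_Ici.2 (by nlinarith [hz.1])
    have mem_false : ∀ z ∈ Set.Icc (0 : ℝ) 1,
        1 - (π * p + (1 - π) * z) ∈ Set.Ici (π * (1 - p)) :=
      fun z hz => Set.mem_Ici.2 (by nlinarith [hz.2])
    have h_true := true_branch.2 (mem_true x hx) (mem_true y hy) hα hβ hαβ
    have h_false := false_branch.2 (mem_false x hx) (mem_false y hy) hα hβ hαβ
    have affine_true : α * (π * p + (1 - π) * x) + β * (π * p + (1 - π) * y)
        = π * p + (1 - π) * (α * x + β * y) := by
      linear_combination π * p * hαβ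
    have affine_false : α * (1 - (π * p + (1 - π) * x)) + β * (1 - (π * p + (1 - π) * y))
        = 1 - (π * p + (1 - π) * (α * x + β * y)) := by
      linear_combination (1 - π * p) * hαβ
    simp only [smul_eq_mul, affine_true, affine_false] at h_true h_false ⊢
    rw [hμ x, hμ y, hμ (α * x + β * y)]
    linarith
  exact hμ_concave.min_le_of_mem_Icc ⟨h₀, h₀₁.trans h₁⟩ ⟨h₀.trans h₀₁, h₁⟩ hq
end
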